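/- For every graph sequence 𝒢 and every prime p, β_ℚ(𝒢) ≤ β_{F_p}(𝒢) ≤ c(𝒢) − 1. -/

import Mathlib

open Filter Function Set
open scoped Classical TensorProduct Pointwise symmDiff

universe u

namespace GraphSeqPaper

/-- The space of `K`-valued antisymmetric functions supported on the (oriented) edges of `G`:
the `K`-vector space spanned by the edges with the convention `(x,y) = -(y,x)`. -/
def edgeSpace (K : Type*) [Field K] {V : Type u} (G : SimpleGraph V) :
    Submodule K (V → V → K) where
  carrier := {f | (∀ x y, ¬ G.Adj x y → f x y = 0) ∧ ∀ x y, f x y = - f y x}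
  add_mem' := by
    rintro f g ⟨hf1, hf2⟩ ⟨hg1, hg2⟩
    refine ⟨fun x y h => ?_, fun x y => ?_⟩
    · simp only [Pi.add_apply, hf1 x y h, hg1 x y h, add_zero]
    · simp only [Pi.add_apply, hf2 x y, hg2 x y]; ring
  zero_mem' := ⟨fun x y _ => rfl, fun x y => by simp⟩
  smul_mem' := by
    rintro c f ⟨hf1, hf2⟩
    refine ⟨fun x y h => ?_, fun x y => ?_⟩
    · simp only [Pi.smul_apply, hf1 x y h, smul_zero]
    · simp only [Pi.smul_apply, hf2 x y, smul_neg]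

lemma edgeSpace_mono (K : Type*) [Field K] {V : Type u} {H G : SimpleGraph V}
    (h : H ≤ G) : edgeSpace K H ≤ edgeSpace K G :=
  fun f hf => ⟨fun x y hxy => hf.1 x y fun ha => hxy (h ha), hf.2⟩

/-- The basis vector of `ε_K` associated to the oriented edge `(x,y)`. -/
noncomputable def edgeVec (K : Type*) [Field K] {V : Type u} (x y : V) : V → V → K :=
  fun a b => if a = x ∧ b = y then (1 : K) else if a = y ∧ b = x then (-1 : K) else 0

/-- The vector of a walk `(x₀, x₁, …, x_l)`, namely `Σ_{i} (x_i, x_{i+1})`. -/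
noncomputable def walkVec (K : Type*) [Field K] {V : Type u} {G : SimpleGraph V} :
    ∀ {x y : V}, G.Walk x y → (V → V → K)
  | _, _, SimpleGraph.Walk.nil => 0
  | _, _, @SimpleGraph.Walk.cons _ _ a b _ _ p => edgeVec K a b + walkVec K p

/-- `C^q_K(G)`: the subspace of `ε_K(G)` spanned by the vectors of cycles of length at most
`q`. -/
noncomputable def cycleSpace (K : Type*) [Field K] {V : Type u} (G : SimpleGraph V) (q : ℕ) :
    Submodule K (V → V → K) :=
  Submodule.span K
    {f | ∃ (x : V) (c : G.Walk x x), c.IsCycle ∧ c.length ≤ q ∧ f = walkVec K c}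

/-- A graph sequence: finite simple graphs, of uniformly bounded vertex degrees, whose number
of vertices tends to infinity. -/
def IsGraphSeq (V : ℕ → Type u) (G : ∀ n, SimpleGraph (V n)) : Prop :=
  (∀ n, Finite (V n)) ∧
    (∃ D : ℕ, ∀ n (x : V n), ((G n).neighborSet x).ncard ≤ D) ∧
      Tendsto (fun n => Nat.card (V n)) atTop atTop

/-- `ℋ ≺ 𝒢`: there is an integer `L > 0` with `d_{G_n}(x,y) ≤ L · d_{H_n}(x,y)` for all `n`
and all vertices `x, y`. -/
def Prec {V : ℕ → Type u} (H G : ∀ n, SimpleGraph (V n)) : Prop :=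
  ∃ L : ℕ, 0 < L ∧ ∀ n (x y : V n), (G n).dist x y ≤ L * (H n).dist x y

/-- `𝒢 ≃ ℋ`: `ℋ ≺ 𝒢` and `𝒢 ≺ ℋ`. -/
def GEquiv {V : ℕ → Type u} (G H : ∀ n, SimpleGraph (V n)) : Prop :=
  Prec H G ∧ Prec G H

/-- The edge number `e(𝒢) = liminf |E(G_n)|/|V(G_n)|`. -/
noncomputable def edgeNum {V : ℕ → Type u} (G : ∀ n, SimpleGraph (V n)) : ℝ :=
  liminf (fun n => ((G n).edgeSet.ncard : ℝ) / (Nat.card (V n) : ℝ)) atTop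

/-- The cost `c(𝒢) = inf { e(ℋ) : ℋ ≃ 𝒢 }`. -/
noncomputable def cost {V : ℕ → Type u} (G : ∀ n, SimpleGraph (V n)) : ℝ :=
  sInf {r : ℝ | ∃ H : ∀ n, SimpleGraph (V n), IsGraphSeq V H ∧ GEquiv G H ∧ r = edgeNum H}

/-- `s^q_K(𝒢) = liminf (|E(G_n)| - dim_K C^q_K(G_n))/|V(G_n)| - 1`. -/
noncomputable def sInv (K : Type*) [Field K] {V : ℕ → Type u}
    (G : ∀ n, SimpleGraph (V n)) (q : ℕ) : ℝ :=
  liminf (fun n =>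
    (((G n).edgeSet.ncard : ℝ) - (Module.finrank K (cycleSpace K (G n) q) : ℝ)) /
      (Nat.card (V n) : ℝ)) atTop - 1

/-- `β_K(𝒢) = inf_q s^q_K(𝒢)`. -/
noncomputable def beta (K : Type*) [Field K] {V : ℕ → Type u}
    (G : ∀ n, SimpleGraph (V n)) : ℝ :=
  ⨅ q : ℕ, sInv K G q

/-- A large girth sequence: for every `k ≥ 1`, all but finitely many `G_n` contain no cycle of
length at most `k`. -/
def LargeGirth {V : ℕ → Type u} (G : ∀ n, SimpleGraph (V n)) : Prop :=
  ∀ k : ℕ, 1 ≤ k → ∃ N : ℕ, ∀ n, N ≤ n →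
    ∀ (x : V n) (c : (G n).Walk x x), c.IsCycle → k < c.length

/-- The set of edges of `G` whose two endpoints lie in different classes of the partition given
by the fibres of `P`. -/
def crossEdges {V : Type u} (G : SimpleGraph V) (P : V → ℕ) : Set (Sym2 V) :=
  {e | e ∈ G.edgeSet ∧ ∃ x ∈ e, ∃ y ∈ e, P x ≠ P y}

/-- Hyperfiniteness of a graph sequence. -/
def Hyperfinite {V : ℕ → Type u} (G : ∀ n, SimpleGraph (V n)) : Prop :=
  ∀ ε : ℝ, 0 < ε → ∃ Kb : ℕ, ∃ P : ∀ n, V n → ℕ,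
    (∀ n i, {x : V n | P n x = i}.ncard ≤ Kb) ∧
      liminf (fun n => ((crossEdges (G n) (P n)).ncard : ℝ) / (Nat.card (V n) : ℝ)) atTop ≤ ε

/-- The Cayley graph of a group with respect to a (symmetric) set `T`:
`x ~ y` iff `x ≠ y` and `y x⁻¹ ∈ T` (or `x y⁻¹ ∈ T`). -/
def cayley (Q : Type u) [Group Q] (T : Set Q) : SimpleGraph Q :=
  SimpleGraph.fromRel (fun x y => y * x⁻¹ ∈ T)

/-- The Cayley graph of the quotient `Γ ⧸ N` with respect to the image of `S`. -/
def cayleyQuot {Γ : Type u} [Group Γ] (N : Subgroup Γ) (hN : N.Normal) (S : Set Γ) :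
    SimpleGraph (Γ ⧸ N) :=
  haveI := hN
  cayley (Γ ⧸ N) ((fun g => (QuotientGroup.mk g : Γ ⧸ N)) '' S)

/-- The minimal number of generators of a group. -/
noncomputable def minGens (Λ : Type u) [Group Λ] : ℕ :=
  sInf {d : ℕ | ∃ T : Set Λ, T.Finite ∧ T.ncard = d ∧ Subgroup.closure T = ⊤}

/-- A group is finitely presented. -/
def FinitelyPresentedGroup (Γ : Type u) [Group Γ] : Prop :=
  ∃ (n : ℕ) (f : FreeGroup (Fin n) →* Γ) (R : Set (FreeGroup (Fin n))),
    Surjective f ∧ R.Finite ∧ f.ker = Subgroup.normalClosure R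

/-- Amenability via the Følner condition. -/
def IsAmenableFolner (Γ : Type u) [Group Γ] : Prop :=
  ∀ F : Set Γ, F.Finite → ∀ ε : ℝ, 0 < ε →
    ∃ A : Set Γ, A.Finite ∧ A.Nonempty ∧
      ∀ s ∈ F, (((s • A) ∆ A).ncard : ℝ) ≤ ε * A.ncard

/-- The set of edges of `G` joining `F` to its complement. -/
def edgeBoundary {V : Type u} (G : SimpleGraph V) (F : Set V) : Set (Sym2 V) :=
  {e | e ∈ G.edgeSet ∧ ∃ x ∈ e, ∃ y ∈ e, x ∈ F ∧ y ∉ F}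

section Walks

variable (K : Type*) [Field K] {V : Type u}

lemma edgeVec_swap {x y : V} (h : x ≠ y) : edgeVec K y x = -edgeVec K x y := by
  funext a b
  simp only [edgeVec, Pi.neg_apply]
  split_ifs with h₁ h₂ h₂ <;> simp_all

lemma walkVec_append {G : SimpleGraph V} {x y z : V} (p : G.Walk x y) (q : G.Walk y z) :
    walkVec K (p.append q) = walkVec K p + walkVec K q := by
  induction p with
  | nil => simp [walkVec]
  | cons h p ih => simp [walkVec, ih, add_assoc]

lemma walkVec_reverse {G : SimpleGraph V} {x y : V} (p : G.Walk x y) :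
    walkVec K p.reverse = -walkVec K p := by
  induction p with
  | nil => simp [walkVec]
  | cons h p ih =>
    simp only [SimpleGraph.Walk.reverse_cons, walkVec_append, ih, walkVec,
      edgeVec_swap K h.ne]
    abel

/-- Closing up a path by an edge gives either a cycle or a backtracking walk. -/
lemma walkVec_cons_mem_cycleSpace {G : SimpleGraph V} {x y : V} (h : G.Adj x y)
    {p : G.Walk y x} (hp : p.IsPath) {q : ℕ} (hq : p.length + 1 ≤ q) :
    walkVec K (SimpleGraph.Walk.cons h p) ∈ cycleSpace K G q := by
  by_cases hc : (SimpleGraph.Walk.cons h p).IsCycle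
  · exact Submodule.subset_span ⟨x, _, hc, by simpa using hq, rfl⟩
  · rw [SimpleGraph.Walk.cons_isCycle_iff] at hc
    have he : s(x, y) ∈ p.edges := by
      by_contra hn
      exact hc ⟨hp, hn⟩
    cases p with
    | nil => exact absurd rfl h.ne
    | @cons _ w _ h' r =>
      rw [SimpleGraph.Walk.cons_isPath_iff] at hp
      rw [SimpleGraph.Walk.edges_cons, List.mem_cons] at he
      rcases he with he | he
      · have hw : w = x := by
          rcases Sym2.eq_iff.1 he with ⟨h₁, -⟩ | ⟨h₁, -⟩
          · exact absurd h₁ h.ne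
          · exact h₁.symm
        subst hw
        rw [(SimpleGraph.Walk.isPath_iff_nil.1 hp.1).eq_nil]
        simp [walkVec, edgeVec_swap K h.ne]
      · exact absurd (r.snd_mem_support_of_mem_edges he) hp.2

lemma walkVec_sub_bypass_mem_cycleSpace {G : SimpleGraph V} {x y : V} (p : G.Walk x y) {q : ℕ}
    (hq : p.length ≤ q) : walkVec K p - walkVec K p.bypass ∈ cycleSpace K G q := by
  induction p with
  | nil => simp [SimpleGraph.Walk.bypass]
  | @cons u v w h p ih =>
    rw [SimpleGraph.Walk.length_cons] at hq
    have ih := ih (by omega)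
    simp only [SimpleGraph.Walk.bypass]
    split_ifs with hs
    · have hlen := (p.bypass.length_takeUntil_le_length hs).trans p.length_bypass_le_length
      have hcyc := walkVec_cons_mem_cycleSpace K h (p.bypass_isPath.takeUntil hs)
        (q := q) (by omega)
      have hsplit := walkVec_append K (p.bypass.takeUntil u hs) (p.bypass.dropUntil u hs)
      rw [SimpleGraph.Walk.take_spec] at hsplit
      convert add_mem ih hcyc using 1
      simp only [walkVec, hsplit]
      abel
    · simpa [walkVec] using ih

lemma walkVec_closed_mem_cycleSpace {G : SimpleGraph V} {x : V} (p : G.Walk x x) {q : ℕ}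
    (hq : p.length ≤ q) : walkVec K p ∈ cycleSpace K G q := by
  have h := walkVec_sub_bypass_mem_cycleSpace K p hq
  rw [(SimpleGraph.Walk.isPath_iff_nil.1 p.bypass_isPath).eq_nil] at h
  simpa [walkVec] using h

end Walks

section EdgeSpan

variable (K : Type*) [Field K] {V : Type u}

/-- The span of the edge vectors of `G`, one orientation being chosen for every edge. -/
noncomputable def edgeSpan (G : SimpleGraph V) : Submodule K (V → V → K) :=
  Submodule.span K (range fun e : G.edgeSet => edgeVec K e.1.out.1 e.1.out.2)

lemma adj_out {G : SimpleGraph V} (e : G.edgeSet) : G.Adj e.1.out.1 e.1.out.2 := by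
  rw [← SimpleGraph.mem_edgeSet]
  convert e.2
  exact Quot.out_eq e.1

lemma out_eq_or_swap {G : SimpleGraph V} {x y : V} (h : G.Adj x y) :
    ∃ e : G.edgeSet, (e.1.out = (x, y)) ∨ (e.1.out = (y, x)) := by
  refine ⟨⟨s(x, y), h⟩, ?_⟩
  have he : s((s(x, y) : Sym2 V).out.1, (s(x, y) : Sym2 V).out.2) = s(x, y) := Quot.out_eq _
  rcases Sym2.eq_iff.1 he with ⟨h₁, h₂⟩ | ⟨h₁, h₂⟩
  · exact Or.inl (Prod.ext h₁ h₂)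
  · exact Or.inr (Prod.ext h₁ h₂)

lemma edgeVec_mem_edgeSpan {G : SimpleGraph V} {x y : V} (h : G.Adj x y) :
    edgeVec K x y ∈ edgeSpan K G := by
  obtain ⟨e, he⟩ := out_eq_or_swap h
  have hmem : edgeVec K e.1.out.1 e.1.out.2 ∈ edgeSpan K G :=
    Submodule.subset_span (mem_range_self e)
  rcases he with he | he <;> rw [he] at hmem
  · exact hmem
  · rw [edgeVec_swap K h.ne.symm]
    exact neg_mem hmem

lemma walkVec_mem_edgeSpan {G : SimpleGraph V} {x y : V} (p : G.Walk x y) :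
    walkVec K p ∈ edgeSpan K G := by
  induction p with
  | nil => exact zero_mem _
  | cons h p ih => exact add_mem (edgeVec_mem_edgeSpan K h) ih

lemma cycleSpace_le_edgeSpan (G : SimpleGraph V) (q : ℕ) : cycleSpace K G q ≤ edgeSpan K G := by
  refine Submodule.span_le.2 ?_
  rintro _ ⟨x, c, -, -, rfl⟩
  exact walkVec_mem_edgeSpan K c

lemma linearIndependent_edgeVec [Finite V] (G : SimpleGraph V) :
    LinearIndependent K fun e : G.edgeSet => edgeVec K e.1.out.1 e.1.out.2 := by
  have := Fintype.ofFinite G.edgeSet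
  rw [Fintype.linearIndependent_iff]
  intro g hg e
  have h := congrFun (congrFun hg e.1.out.1) e.1.out.2
  simp only [Finset.sum_apply, Pi.smul_apply, Pi.zero_apply, smul_eq_mul] at h
  rw [Finset.sum_eq_single e] at h
  · simpa [edgeVec] using h
  · intro e' _ hne
    have hout : s(e.1.out.1, e.1.out.2) ≠ s(e'.1.out.1, e'.1.out.2) := by
      intro heq
      apply hne
      have h₁ : s(e.1.out.1, e.1.out.2) = e.1 := Quot.out_eq _
      have h₂ : s(e'.1.out.1, e'.1.out.2) = e'.1 := Quot.out_eq _
      exact Subtype.ext (by rw [← h₁, ← h₂, heq])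
    rw [Ne, Sym2.eq_iff, not_or] at hout
    simp [edgeVec, hout.1, hout.2]
  · simp

lemma finrank_edgeSpan [Finite V] (G : SimpleGraph V) :
    Module.finrank K (edgeSpan K G) = G.edgeSet.ncard := by
  have := Fintype.ofFinite G.edgeSet
  rw [edgeSpan, finrank_span_eq_card (linearIndependent_edgeVec K G), ← Nat.card_eq_fintype_card,
    Nat.card_coe_set_eq]

lemma finrank_cycleSpace_le [Finite V] (G : SimpleGraph V) (q : ℕ) :
    Module.finrank K (cycleSpace K G q) ≤ G.edgeSet.ncard := by
  rw [← finrank_edgeSpan K G]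
  exact Submodule.finrank_mono (cycleSpace_le_edgeSpan K G q)

end EdgeSpan

section Comparison

variable (K : Type*) [Field K] {V : Type u}

lemma exists_submodule_walkVec_mem [Finite V] {G H : SimpleGraph V} {L : ℕ}
    (hL : ∀ x y, H.Adj x y → ∃ p : G.Walk x y, p.length ≤ L) :
    ∃ W : Submodule K (V → V → K), Module.finrank K W ≤ H.edgeSet.ncard ∧
      ∀ x y (w : H.Walk x y),
        ∃ p : G.Walk x y, p.length ≤ L * w.length ∧ walkVec K p ∈ W := by
  have := Fintype.ofFinite H.edgeSet
  choose P hP using hL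
  let b : H.edgeSet → V → V → K := fun e => walkVec K (P _ _ (adj_out e))
  have hadj : ∀ x y, H.Adj x y →
      ∃ p : G.Walk x y, p.length ≤ L ∧ walkVec K p ∈ Submodule.span K (range b) := by
    intro x y h
    obtain ⟨e, he⟩ := out_eq_or_swap h
    have hmem : b e ∈ Submodule.span K (range b) := Submodule.subset_span (mem_range_self e)
    have hlen := hP _ _ (adj_out e)
    have key : ∀ x' y', e.1.out = (x', y') →
        ∃ p : G.Walk x' y', p.length ≤ L ∧ walkVec K p ∈ Submodule.span K (range b) := by
      rintro x' y' h'
      obtain rfl : e.1.out.1 = x' := by rw [h']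
      obtain rfl : e.1.out.2 = y' := by rw [h']
      exact ⟨_, hlen, hmem⟩
    rcases he with he | he
    · exact key _ _ he
    · obtain ⟨p, hp, hpW⟩ := key _ _ he
      refine ⟨p.reverse, by simpa using hp, ?_⟩
      rw [walkVec_reverse]
      exact neg_mem hpW
  refine ⟨Submodule.span K (range b), ?_, ?_⟩
  · rw [← Nat.card_coe_set_eq, Nat.card_eq_fintype_card]
    exact finrank_range_le_card b
  · intro x y w
    induction w with
    | nil => exact ⟨SimpleGraph.Walk.nil, by simp, zero_mem _⟩
    | cons h w ih =>
      obtain ⟨p, hp, hpW⟩ := hadj _ _ h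
      obtain ⟨r, hr, hrW⟩ := ih
      refine ⟨p.append r, ?_, ?_⟩
      · rw [SimpleGraph.Walk.length_append, SimpleGraph.Walk.length_cons, mul_add, mul_one]
        omega
      · rw [walkVec_append]
        exact add_mem hpW hrW

lemma edgeSet_ncard_le_finrank_cycleSpace_add [Finite V] {G H : SimpleGraph V} {L M : ℕ}
    (hL : ∀ x y, H.Adj x y → ∃ p : G.Walk x y, p.length ≤ L)
    (hM : ∀ x y, G.Adj x y → ∃ p : H.Walk x y, p.length ≤ M) :
    G.edgeSet.ncard ≤ Module.finrank K (cycleSpace K G (L * M + 1)) + H.edgeSet.ncard := by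
  obtain ⟨W, hW, hwalk⟩ := exists_submodule_walkVec_mem K hL
  have hle : edgeSpan K G ≤ cycleSpace K G (L * M + 1) ⊔ W := by
    refine Submodule.span_le.2 ?_
    rintro _ ⟨e, rfl⟩
    have h := adj_out e
    obtain ⟨w, hw⟩ := hM _ _ h
    obtain ⟨p, hp, hpW⟩ := hwalk _ _ w
    have hlen : (SimpleGraph.Walk.cons h p.reverse).length ≤ L * M + 1 := by
      have := hp.trans (Nat.mul_le_mul_left L hw)
      simpa using this
    have hc := walkVec_closed_mem_cycleSpace K _ hlen
    have hsum := Submodule.add_mem_sup hc hpW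
    simpa [walkVec, walkVec_reverse] using hsum
  calc G.edgeSet.ncard = Module.finrank K (edgeSpan K G) := (finrank_edgeSpan K G).symm
    _ ≤ Module.finrank K (cycleSpace K G (L * M + 1) ⊔ W : Submodule K (V → V → K)) :=
      Submodule.finrank_mono hle
    _ ≤ _ := (Submodule.finrank_add_le_finrank_add_finrank _ _).trans (by omega)

lemma exists_walk_of_dist_le {G H : SimpleGraph V} {L M : ℕ}
    (hL : ∀ x y, G.dist x y ≤ L * H.dist x y) (hM : ∀ x y, H.dist x y ≤ M * G.dist x y)
    {x y : V} (h : G.Adj x y) : ∃ p : H.Walk x y, p.length ≤ M := by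
  have h₁ := hL x y
  have h₂ := hM x y
  rw [SimpleGraph.dist_eq_one_iff_adj.2 h] at h₁ h₂
  have hne : H.dist x y ≠ 0 := by
    intro h0
    simp [h0] at h₁
  obtain ⟨p, hp⟩ := SimpleGraph.exists_walk_of_dist_ne_zero hne
  exact ⟨p, by omega⟩

end Comparison

section Reduction

/-- Integer vectors that are linearly independent modulo `p` are linearly independent
over `ℚ`. -/
lemma linearIndependent_rat_of_zmod {ι κ : Type*} (p : ℕ) [Fact p.Prime] (v : ι → κ → ℤ)
    (h : LinearIndependent (ZMod p) fun i k => (v i k : ZMod p)) :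
    LinearIndependent ℚ fun i k => (v i k : ℚ) := by
  rw [← LinearIndependent.iff_fractionRing ℤ ℚ, linearIndependent_iff']
  intro s g hg
  by_contra! hne
  obtain ⟨i, his, hi⟩ := hne
  obtain ⟨g', hg', hgcd⟩ := Finset.extract_gcd g ⟨i, his⟩
  have hd : s.gcd g ≠ 0 := fun h0 => hi (by rw [hg' i his, h0, zero_mul])
  have hsum : ∀ k, ∑ j ∈ s, g' j * v j k = 0 := by
    intro k
    have hk := congrFun hg k
    simp only [Finset.sum_apply, Pi.smul_apply, Pi.zero_apply, ← Int.cast_smul_eq_zsmul ℚ,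
      smul_eq_mul] at hk
    have hk' : ∑ j ∈ s, g j * v j k = 0 := by exact_mod_cast hk
    rw [Finset.sum_congr rfl fun j hj => by rw [hg' j hj, mul_assoc], ← Finset.mul_sum] at hk'
    exact (mul_eq_zero.1 hk').resolve_left hd
  have hzero := linearIndependent_iff'.1 h s (fun j => (g' j : ZMod p)) (by
    funext k
    have hk := congrArg (Int.cast : ℤ → ZMod p) (hsum k)
    push_cast at hk
    simpa [Finset.sum_apply] using hk)
  have hdvd : (p : ℤ) ∣ s.gcd g' :=
    Finset.dvd_gcd fun j hj => (ZMod.intCast_zmod_eq_zero_iff_dvd _ p).1 (hzero j hj)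
  rw [hgcd] at hdvd
  have hp := (Fact.out : p.Prime).one_lt
  have := Int.le_of_dvd one_pos hdvd
  omega

lemma exists_int_walkVec {V : Type u} {G : SimpleGraph V} {x y : V} (w : G.Walk x y) :
    ∃ f : V → V → ℤ, ∀ (K : Type) [Field K], walkVec K w = fun a b => (f a b : K) := by
  induction w with
  | nil => exact ⟨0, fun K _ => by funext a b; simp [walkVec]⟩
  | @cons u v _ _ w ih =>
    obtain ⟨f, hf⟩ := ih
    refine ⟨fun a b => (if a = u ∧ b = v then 1 else if a = v ∧ b = u then -1 else 0) + f a b,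
      fun K _ => ?_⟩
    funext a b
    simp only [walkVec, hf K, Pi.add_apply, edgeVec]
    push_cast
    rfl

lemma finrank_cycleSpace_zmod_le_rat {V : Type u} [Finite V] (G : SimpleGraph V) (q p : ℕ)
    [Fact p.Prime] :
    Module.finrank (ZMod p) (cycleSpace (ZMod p) G q) ≤
      Module.finrank ℚ (cycleSpace ℚ G q) := by
  obtain ⟨b, hb, hspan, hli⟩ := exists_linearIndependent (ZMod p)
    {f | ∃ (x : V) (c : G.Walk x x), c.IsCycle ∧ c.length ≤ q ∧ f = walkVec (ZMod p) c}
  have := hli.finite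
  have := Fintype.ofFinite b
  have hlift : ∀ i : b, ∃ v : V → V → ℤ, (fun x y => (v x y : ZMod p)) = i.1 ∧
      (fun x y => (v x y : ℚ)) ∈ cycleSpace ℚ G q := by
    intro i
    obtain ⟨x, c, hc, hlen, hi⟩ := hb i.2
    obtain ⟨f, hf⟩ := exists_int_walkVec c
    refine ⟨f, ?_, ?_⟩
    · rw [hi, hf]
    · rw [← hf ℚ]
      exact Submodule.subset_span ⟨x, c, hc, hlen, rfl⟩
  choose v hv hvmem using hlift
  have hliZ : LinearIndependent (ZMod p)
      fun (i : b) (k : V × V) => (v i k.1 k.2 : ZMod p) := by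
    have hmap := hli.map' (LinearEquiv.curry (ZMod p) (ZMod p) V V).symm.toLinearMap
      (LinearEquiv.ker _)
    have heq : (fun (i : b) (k : V × V) => (v i k.1 k.2 : ZMod p)) =
        (LinearEquiv.curry (ZMod p) (ZMod p) V V).symm.toLinearMap ∘ Subtype.val := by
      funext i k
      exact congrFun (congrFun (hv i) k.1) k.2
    rw [heq]
    exact hmap
  have hliQ := (linearIndependent_rat_of_zmod p (fun (i : b) (k : V × V) => v i k.1 k.2) hliZ).map'
    (LinearEquiv.curry ℚ ℚ V V).toLinearMap (LinearEquiv.ker _)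
  have hle : Submodule.span ℚ (range fun (i : b) (x y : V) => (v i x y : ℚ)) ≤
      cycleSpace ℚ G q := by
    refine Submodule.span_le.2 ?_
    rintro _ ⟨i, rfl⟩
    exact hvmem i
  calc Module.finrank (ZMod p) (cycleSpace (ZMod p) G q) = Fintype.card b := by
        rw [cycleSpace, ← hspan]
        conv_lhs => rw [← Subtype.range_coe (s := b)]
        exact finrank_span_eq_card hli
    _ = Module.finrank ℚ
        (Submodule.span ℚ (range fun (i : b) (x y : V) => (v i x y : ℚ))) :=
      (finrank_span_eq_card hliQ).symm
    _ ≤ _ := Submodule.finrank_mono hle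

end Reduction

section Sequences

lemma edgeSet_ncard_le {V : Type u} [Finite V] (G : SimpleGraph V) {D : ℕ}
    (hD : ∀ x, (G.neighborSet x).ncard ≤ D) : G.edgeSet.ncard ≤ D * Nat.card V := by
  have := Fintype.ofFinite V
  have hsum := G.sum_degrees_eq_twice_card_edges
  have hle : ∑ x, G.degree x ≤ ∑ _x : V, D := by
    refine Finset.sum_le_sum fun x _ => ?_
    rw [← SimpleGraph.card_neighborSet_eq_degree, ← Nat.card_eq_fintype_card,
      Nat.card_coe_set_eq]
    exact hD x
  rw [Finset.sum_const, Finset.card_univ, smul_eq_mul, hsum] at hle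
  rw [← SimpleGraph.coe_edgeFinset, ncard_coe_finset, Nat.card_eq_fintype_card, mul_comm D]
  omega

variable {V : ℕ → Type u} {G : ∀ n, SimpleGraph (V n)}

lemma IsGraphSeq.exists_edge_bound (hG : IsGraphSeq V G) :
    ∃ D : ℕ, ∀ n, ((G n).edgeSet.ncard : ℝ) / (Nat.card (V n) : ℝ) ≤ D := by
  obtain ⟨hfin, ⟨D, hD⟩, -⟩ := hG
  refine ⟨D, fun n => ?_⟩
  have := hfin n
  refine div_le_of_le_mul₀ (Nat.cast_nonneg _) (Nat.cast_nonneg _) ?_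
  exact_mod_cast edgeSet_ncard_le (G n) (hD n)

lemma isCoboundedUnder_ge_of_le {f : ℕ → ℝ} {D : ℝ} (h : ∀ n, f n ≤ D) :
    IsCoboundedUnder (· ≥ ·) atTop f :=
  (isBoundedUnder_of ⟨D, h⟩ : IsBoundedUnder (· ≤ ·) atTop f).isCoboundedUnder_ge

lemma isBoundedUnder_ge_of_nonneg {f : ℕ → ℝ} (h : ∀ n, 0 ≤ f n) :
    IsBoundedUnder (· ≥ ·) atTop f :=
  isBoundedUnder_of ⟨0, h⟩

variable (K : Type*) [Field K]

lemma IsGraphSeq.excess_nonneg (hG : IsGraphSeq V G) (q n : ℕ) :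
    0 ≤ (((G n).edgeSet.ncard : ℝ) - (Module.finrank K (cycleSpace K (G n) q) : ℝ)) /
      (Nat.card (V n) : ℝ) := by
  have := hG.1 n
  refine div_nonneg (sub_nonneg.2 ?_) (Nat.cast_nonneg _)
  exact_mod_cast finrank_cycleSpace_le K (G n) q

lemma IsGraphSeq.isCoboundedUnder_excess (hG : IsGraphSeq V G) (q : ℕ) :
    IsCoboundedUnder (· ≥ ·) atTop fun n =>
      (((G n).edgeSet.ncard : ℝ) - (Module.finrank K (cycleSpace K (G n) q) : ℝ)) /
        (Nat.card (V n) : ℝ) := by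
  obtain ⟨D, hD⟩ := hG.exists_edge_bound
  refine isCoboundedUnder_ge_of_le fun n => le_trans ?_ (hD n)
  gcongr
  simp

lemma IsGraphSeq.bddBelow_sInv (hG : IsGraphSeq V G) : BddBelow (range (sInv K G)) := by
  refine ⟨-1, ?_⟩
  rintro _ ⟨q, rfl⟩
  have h := le_liminf_of_le (hG.isCoboundedUnder_excess K q)
    (Eventually.of_forall (hG.excess_nonneg K q))
  rw [sInv]
  linarith

lemma beta_rat_le_beta_zmod (hG : IsGraphSeq V G) (p : ℕ) [Fact p.Prime] :
    beta ℚ G ≤ beta (ZMod p) G := by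
  refine ciInf_mono (hG.bddBelow_sInv ℚ) fun q => sub_le_sub_right ?_ 1
  refine liminf_le_liminf (Eventually.of_forall fun n => ?_)
    (isBoundedUnder_ge_of_nonneg (hG.excess_nonneg ℚ q)) (hG.isCoboundedUnder_excess (ZMod p) q)
  have := hG.1 n
  have hle := finrank_cycleSpace_zmod_le_rat (G n) q p
  gcongr

lemma beta_le_cost_sub_one (hG : IsGraphSeq V G) : beta K G ≤ cost G - 1 := by
  rw [le_sub_iff_add_le]
  refine le_csInf ⟨edgeNum G, G, hG, ?_, rfl⟩ ?_
  · exact ⟨⟨1, one_pos, fun _ _ _ => by simp⟩, ⟨1, one_pos, fun _ _ _ => by simp⟩⟩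
  · rintro _ ⟨H, hH, ⟨⟨L, -, hL⟩, ⟨M, -, hM⟩⟩, rfl⟩
    rw [← le_sub_iff_add_le]
    refine (ciInf_le (hG.bddBelow_sInv K) (L * M + 1)).trans (sub_le_sub_right ?_ 1)
    obtain ⟨D, hD⟩ := hH.exists_edge_bound
    refine liminf_le_liminf (Eventually.of_forall fun n => ?_)
      (isBoundedUnder_ge_of_nonneg (hG.excess_nonneg K _)) (isCoboundedUnder_ge_of_le hD)
    have := hG.1 n
    have hle := edgeSet_ncard_le_finrank_cycleSpace_add K
      (fun x y h => exists_walk_of_dist_le (hM n) (hL n) h)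
      (fun x y h => exists_walk_of_dist_le (hL n) (hM n) h)
    gcongr
    rw [sub_le_iff_le_add']
    exact_mod_cast hle

end Sequences

theorem beta_rat_le_beta_zmod_le_cost {V : ℕ → Type u}
    (G : ∀ n, SimpleGraph (V n)) (hG : IsGraphSeq V G) (p : ℕ) [Fact p.Prime] :
    beta ℚ G ≤ beta (ZMod p) G ∧ beta (ZMod p) G ≤ cost G - 1 :=
  ⟨beta_rat_le_beta_zmod hG p, beta_le_cost_sub_one (ZMod p) hG⟩

end GraphSeqPaper
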